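/- Let M be a compact metric space, let G be the space of homeomorphisms of M with the topology of uniform convergence of maps and their inverses, and let μ be a Borel probability measure on G. Let Ω = G^ℤ with product measure μ^ℤ, Ω⁺ = G^ℕ with product measure μ^ℕ, σ the left shift on Ω, F:Ω×M→Ω×M the skew product F(ω,x) = (σ(ω), ω₀(x)), and P⁺:Ω×M→Ω⁺×M the map restricting the sequence ω to its nonnegative coordinates. Then for every μ-stationary Borel probability measure ν on M there exists a unique Borel probability measure ν̂ on Ω×M such that: (1) ν̂ is F-invariant, and (2) P⁺_*(ν̂) = μ^ℕ⊗ν. Furthermore, disintegrating ν̂ with respect to the projection P:Ω×M→Ω yields a family of Borel probability measures {ν_ω}_{ω∈Ω} on M with ν̂ = ∫_Ω (δ_ω ⊗ ν_ω) dμ^ℤ(ω), and for μ^ℤ-almost every ω = (…,f₋₂,f₋₁,f₀,f₁,…), the measure ν_ω depends only on the negative coordinates ω⁻ = (…,f₋₂,f₋₁). -/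

import Mathlib

open MeasureTheory
open scoped ENNReal

/-- The topology of uniform convergence of maps together with their inverses on the group of
homeomorphisms of a compact metric space. -/
noncomputable instance homeoTop (M : Type*) [MetricSpace M] [CompactSpace M] :
    TopologicalSpace (M ≃ₜ M) :=
  TopologicalSpace.induced
    (fun h : M ≃ₜ M =>
      ((ContinuousMap.mk ⇑h h.continuous : C(M, M)),
        (ContinuousMap.mk ⇑h.symm h.symm.continuous : C(M, M))))
    inferInstance

/-- The associated Borel measurable structure on the homeomorphism group. -/
noncomputable instance homeoMeasurable (M : Type*) [MetricSpace M] [CompactSpace M] :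
    MeasurableSpace (M ≃ₜ M) := borel _

section Helpers

open Filter Topology ProbabilityTheory

section WeakLimits

variable {Θ M : Type*} [MeasurableSpace Θ] [MetricSpace M] [MeasurableSpace M] [BorelSpace M]

/-- A pointwise weak limit of measurable families of probability measures is measurable. -/
theorem measurable_probabilityMeasure_of_tendsto {m : ℕ → Θ → ProbabilityMeasure M}
    {k : Θ → ProbabilityMeasure M} (hm : ∀ n, Measurable (m n))
    (hlim : ∀ θ, Tendsto (fun n => m n θ) atTop (𝓝 (k θ))) :
    Measurable fun θ => (k θ : Measure M) := by
  refine Measurable.measure_of_isPiSystem_of_isProbabilityMeasure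
    (BorelSpace.measurable_eq.trans borel_eq_generateFrom_isClosed) isPiSystem_isClosed
    fun F hF => ?_
  refine measurable_of_tendsto_metrizable (f := fun j θ => ∫⁻ x, hF.apprSeq j x ∂(k θ : Measure M))
    (fun j => ?_) (tendsto_pi_nhds.2 fun θ => HasOuterApproxClosed.tendsto_lintegral_apprSeq hF _)
  refine measurable_of_tendsto_metrizable
    (f := fun n θ => ∫⁻ x, hF.apprSeq j x ∂(m n θ : Measure M)) (fun n => ?_)
    (tendsto_pi_nhds.2 fun θ =>
      (ProbabilityMeasure.tendsto_iff_forall_lintegral_tendsto.1 (hlim θ)) _)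
  exact (Measure.measurable_lintegral (hF.apprSeq j).measurable_coe_ennreal_comp).comp
    (measurable_subtype_coe.comp (hm n))

variable [CompactSpace M]

/-- On a compact metric space, a sequence of probability measures whose integrals against a dense
family of continuous functions converge is weakly convergent. -/
theorem exists_tendsto_probabilityMeasure (d : ℕ → C(M, ℝ)) (hd : DenseRange d)
    (p : ℕ → ProbabilityMeasure M)
    (hp : ∀ i, ∃ c, Tendsto (fun n => ∫ x, d i x ∂(p n : Measure M)) atTop (𝓝 c)) :
    ∃ q, Tendsto p atTop (𝓝 q) := by
  choose c hc using hp
  obtain ⟨q, hq⟩ := exists_clusterPt_of_compactSpace (map p atTop)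
  have key : ∀ r, ClusterPt r (map p atTop) → ∀ i, ∫ x, d i x ∂(r : Measure M) = c i := by
    intro r hr i
    have hcont : Continuous fun r : ProbabilityMeasure M => ∫ x, d i x ∂(r : Measure M) :=
      ProbabilityMeasure.continuous_integral_boundedContinuousFunction
        (BoundedContinuousFunction.mkOfCompact (d i))
    have := hr.map hcont.continuousAt (tendsto_map (x := map p atTop))
    rw [map_map] at this
    have h2 := this.mono (hc i)
    by_contra hne
    exact (h2.neBot).ne ((disjoint_nhds_nhds.2 hne).eq_bot)
  refine ⟨q, le_nhds_of_unique_clusterPt fun r hr => ?_⟩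
  have : IsProbabilityMeasure r.1 := r.2
  have : IsProbabilityMeasure q.1 := q.2
  refine Subtype.ext (ext_of_forall_integral_eq_of_IsFiniteMeasure fun f => ?_)
  have hcts : ∀ r : ProbabilityMeasure M,
      Continuous fun f : C(M, ℝ) => ∫ x, f x ∂(r : Measure M) := by
    intro r
    exact (continuous_integral (μ := (r : Measure M))).comp
      (ContinuousMap.toLp 1 (r : Measure M) ℝ).continuous |>.congr fun f =>
        integral_congr_ae (ContinuousMap.coeFn_toLp (r : Measure M) (𝕜 := ℝ) f)
  have := hd.equalizer (hcts r) (hcts q) (funext fun i => by simp [key r hr, key q hq])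
  exact congrFun this f.toContinuousMap

/-- A sequence of measurable families of probability measures on a compact metric space whose
integrals against each continuous function converge almost surely has an almost sure weak limit,
which can be chosen to be a Markov kernel. -/
theorem exists_kernel_ae_tendsto (P : Measure Θ) (m : ℕ → Kernel Θ M) [∀ n, IsMarkovKernel (m n)]
    (hm : ∀ f : C(M, ℝ), ∀ᵐ θ ∂P, ∃ c, Tendsto (fun n => ∫ x, f x ∂m n θ) atTop (𝓝 c)) :
    ∃ κ : Kernel Θ M, IsMarkovKernel κ ∧ ∀ᵐ θ ∂P, ∀ f : C(M, ℝ),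
      Tendsto (fun n => ∫ x, f x ∂m n θ) atTop (𝓝 (∫ x, f x ∂κ θ)) := by
  classical
  let d := TopologicalSpace.denseSeq C(M, ℝ)
  let E : Set Θ := ⋂ i, {θ | ∃ c, Tendsto (fun n => ∫ x, d i x ∂m n θ) atTop (𝓝 c)}
  have hE : MeasurableSet E := MeasurableSet.iInter fun i =>
    measurableSet_exists_tendsto fun n =>
      ((d i).continuous.stronglyMeasurable.integral_kernel (κ := m n)).measurable
  let m' : ℕ → Θ → ProbabilityMeasure M := fun n θ =>
    if θ ∈ E then ⟨m n θ, inferInstance⟩ else ⟨m 0 θ, inferInstance⟩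
  have hmeas : ∀ n, Measurable (m' n) := fun n =>
    Measurable.ite hE ((m n).measurable.subtype_mk) ((m 0).measurable.subtype_mk)
  have hlim : ∀ θ, ∃ q, Tendsto (fun n => m' n θ) atTop (𝓝 q) := by
    intro θ
    by_cases hθ : θ ∈ E
    · simp only [m', hθ]
      exact exists_tendsto_probabilityMeasure d (TopologicalSpace.denseRange_denseSeq _) _
        fun i => Set.mem_iInter.1 hθ i
    · simp only [m', hθ]
      exact ⟨_, tendsto_const_nhds⟩
  choose k hk using hlim
  refine ⟨⟨fun θ => k θ, measurable_probabilityMeasure_of_tendsto hmeas hk⟩,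
    ⟨fun θ => (k θ).2⟩, ?_⟩
  have hae : ∀ᵐ θ ∂P, θ ∈ E := by
    simp only [E, Set.mem_iInter]
    exact ae_all_iff.2 fun i => hm (d i)
  filter_upwards [hae] with θ hθ f
  have := ProbabilityMeasure.tendsto_iff_forall_integral_tendsto.1 (hk θ)
    (BoundedContinuousFunction.mkOfCompact f)
  simpa [m', hθ] using this

end WeakLimits

section Products

/-- Finite measures that agree on an increasing sequence of generating σ-algebras, given by
measurable maps, are equal. -/
theorem ext_of_map_eq_of_monotone_comap {X : Type*} [mX : MeasurableSpace X] {Y : ℕ → Type*}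
    [∀ k, MeasurableSpace (Y k)] (φ : ∀ k, X → Y k) (hφ : ∀ k, Measurable (φ k))
    (hmono : ∀ k, Measurable[MeasurableSpace.comap (φ (k + 1)) inferInstance] (φ k))
    (hgen : mX ≤ ⨆ k, MeasurableSpace.comap (φ k) inferInstance)
    (ρ ρ' : Measure X) [IsFiniteMeasure ρ] (h : ∀ k, ρ.map (φ k) = ρ'.map (φ k)) : ρ = ρ' := by
  have hle : (⨆ k, MeasurableSpace.comap (φ k) inferInstance) ≤ mX :=
    iSup_le fun k => (hφ k).comap_le
  have hmon : Monotone fun k => MeasurableSpace.comap (φ k) inferInstance :=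
    monotone_nat_of_le_succ fun k => (hmono k).comap_le
  have hset : ∀ k s, MeasurableSet[MeasurableSpace.comap (φ k) inferInstance] s → ρ s = ρ' s := by
    rintro k _ ⟨t, ht, rfl⟩
    rw [← Measure.map_apply (hφ k) ht, h k, Measure.map_apply (hφ k) ht]
  refine ext_of_generate_finite
    (⋃ k, {s | MeasurableSet[MeasurableSpace.comap (φ k) inferInstance] s}) ?_ ?_ ?_ ?_
  · exact (le_antisymm hgen hle).trans (MeasurableSpace.generateFrom_iUnion_measurableSet _).symm
  · exact isPiSystem_iUnion_of_monotone _
      (fun k => @MeasurableSpace.isPiSystem_measurableSet _ (MeasurableSpace.comap (φ k) _))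
      fun i j hij s hs => hmon hij s hs
  · simp only [Set.mem_iUnion]
    rintro s ⟨k, hk⟩
    exact hset k s hk
  · exact hset 0 _ (@MeasurableSet.univ _ (MeasurableSpace.comap (φ 0) _))

variable {G : Type*} [MeasurableSpace G] (μ : Measure G) [IsProbabilityMeasure μ]

/-- The coordinates of a map into a product are measurable with respect to its comap. -/
theorem measurable_comap_apply {X J : Type*} {G : Type*} [MeasurableSpace G] (w : X → J → G)
    (j : J) : Measurable[MeasurableSpace.comap w inferInstance] fun x => w x j :=
  (measurable_pi_apply j).comp (comap_measurable w)

/-- A measure on one-sided sequences with product finite windows is the product measure. -/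
theorem eq_infinitePi_nat_of_map_fin (μN : Measure (ℕ → G))
    (h : ∀ n : ℕ, μN.map (fun ω (i : Fin n) => ω i) = Measure.pi fun _ : Fin n => μ) :
    μN = Measure.infinitePi fun _ => μ := by
  refine Eq.symm (ext_of_map_eq_of_monotone_comap (fun n (ω : ℕ → G) (i : Fin n) => ω i)
    (fun n => by fun_prop) (fun n => ?_) ?_ _ _ fun n => ?_)
  · refine (@measurable_pi_iff _ _ _ (_) _ _).2 fun i => ?_
    exact measurable_comap_apply (fun (ω : ℕ → G) (i : Fin (n + 1)) => ω i) i.castSucc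
  · refine iSup_le fun i => le_trans ?_ (le_iSup _ (i + 1))
    exact (measurable_comap_apply (fun (ω : ℕ → G) (j : Fin (i + 1)) => ω j)
      (Fin.last i)).comap_le
  · rw [h n, Measure.map_infinitePi_infinitePi_of_inj (P := fun _ : ℕ => μ) Fin.val_injective,
      Measure.infinitePi_eq_pi]

/-- A measure on two-sided sequences with product finite windows is the product measure. -/
theorem eq_infinitePi_int_of_map_fin (μZ : Measure (ℤ → G))
    (h : ∀ (k : ℤ) (n : ℕ),
      μZ.map (fun ω (i : Fin n) => ω (k + (i : ℕ))) = Measure.pi fun _ : Fin n => μ) :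
    μZ = Measure.infinitePi fun _ => μ := by
  let w : ∀ n : ℕ, (ℤ → G) → Fin (2 * n + 1) → G := fun n ω i => ω (-n + (i : ℕ))
  have hw : ∀ (n : ℕ) (i : ℤ), i.natAbs ≤ n →
      Measurable[MeasurableSpace.comap (w n) inferInstance] fun ω => ω i := by
    intro n i hi
    have e : -(n : ℤ) + ((i + n).toNat : ℕ) = i := by lia
    have := measurable_comap_apply (w n) ⟨(i + n).toNat, by lia⟩
    simpa only [w, e] using this
  refine Eq.symm (ext_of_map_eq_of_monotone_comap w
    (fun n => by fun_prop) (fun n => ?_) ?_ _ _ fun n => ?_)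
  · exact (@measurable_pi_iff _ _ _ (_) _ _).2 fun i => hw _ _ (by have := i.isLt; omega)
  · exact iSup_le fun i => ((hw i.natAbs i le_rfl).comap_le).trans
      (le_iSup (fun n => MeasurableSpace.comap (w n) inferInstance) i.natAbs)
  · rw [h, Measure.map_infinitePi_infinitePi_of_inj (P := fun _ : ℤ => μ)
      (f := fun i : Fin (2 * n + 1) => -(n : ℤ) + (i : ℕ)), Measure.infinitePi_eq_pi]
    intro i j hij
    simp only at hij
    exact Fin.ext (by lia)

/-- Functions of disjoint blocks of coordinates are independent under a product measure. -/
theorem infinitePi_map_prodMk {ι α β : Type*} [MeasurableSpace α] [MeasurableSpace β]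
    {S T : Set ι} (hST : Disjoint S T) {u : (ι → G) → α} {v : (ι → G) → β}
    (hu : Measurable[⨆ i ∈ S, MeasurableSpace.comap (fun ω : ι → G => ω i) inferInstance] u)
    (hv : Measurable[⨆ i ∈ T, MeasurableSpace.comap (fun ω : ι → G => ω i) inferInstance] v) :
    (Measure.infinitePi fun _ : ι => μ).map (fun ω => (u ω, v ω)) =
      ((Measure.infinitePi fun _ : ι => μ).map u).prod
        ((Measure.infinitePi fun _ : ι => μ).map v) := by
  have hle : ∀ S : Set ι, (⨆ i ∈ S, MeasurableSpace.comap (fun ω : ι → G => ω i) inferInstance) ≤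
      (inferInstance : MeasurableSpace (ι → G)) :=
    fun S => iSup₂_le fun i _ => (measurable_pi_apply i).comap_le
  have hind : iIndepFun (fun i (ω : ι → G) => ω i) (Measure.infinitePi fun _ : ι => μ) :=
    iIndepFun_infinitePi (X := fun _ g => g) fun _ => measurable_id
  have := indep_iSup_of_disjoint (fun i => (measurable_pi_apply i).comap_le) hind hST
  refine (indepFun_iff_map_prod_eq_prod_map_map (hu.mono (hle S) le_rfl).aemeasurable
    (hv.mono (hle T) le_rfl).aemeasurable).1 ?_
  exact indep_of_indep_of_le_left (indep_of_indep_of_le_right this hv.comap_le) hu.comap_le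

/-- A coordinate is measurable with respect to the σ-algebra of a block containing it. -/
theorem measurable_apply_of_mem {ι : Type*} {S : Set ι} {i : ι} (hi : i ∈ S) :
    Measurable[⨆ i ∈ S, MeasurableSpace.comap (fun ω : ι → G => ω i) inferInstance]
      fun ω : ι → G => ω i :=
  (comap_measurable _).mono (le_iSup₂ (f := fun i (_ : i ∈ S) =>
    MeasurableSpace.comap (fun ω : ι → G => ω i) inferInstance) i hi) le_rfl

end Products

section Dynamics

variable {G M : Type*}

/-- The composition `h₀ ∘ h₁ ∘ ⋯ ∘ hₙ₋₁` of the maps given by the first `n` terms of `h`. -/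
def backComp (act : G → M → M) : ℕ → (ℕ → G) → M → M
  | 0, _, x => x
  | n + 1, h, x => backComp act n h (act (h n) x)

theorem backComp_succ_left (act : G → M → M) (n : ℕ) (h : ℕ → G) (x : M) :
    backComp act (n + 1) h x = act (h 0) (backComp act n (fun i => h (i + 1)) x) := by
  induction n generalizing x with
  | zero => rfl
  | succ n ih => exact ih (act (h (n + 1)) x)

theorem backComp_congr (act : G → M → M) {n : ℕ} {h h' : ℕ → G} (hh : ∀ i < n, h i = h' i) :
    backComp act n h = backComp act n h' := by
  induction n with
  | zero => rfl
  | succ n ih =>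
    funext x
    simp only [backComp]
    rw [ih fun i hi => hh i (by lia), hh n (by lia)]

variable [MeasurableSpace G] [MeasurableSpace M]

theorem measurable_backComp {act : G → M → M} (hact : Measurable fun p : G × M => act p.1 p.2)
    (n : ℕ) : Measurable fun p : (ℕ → G) × M => backComp act n p.1 p.2 := by
  induction n with
  | zero => exact measurable_snd
  | succ n ih =>
    exact ih.comp (measurable_fst.prodMk
      (hact.comp (((measurable_pi_apply n).comp measurable_fst).prodMk measurable_snd)))

/-- The kernel sending `h` to the image of `ν` under `h₀ ∘ ⋯ ∘ hₙ₋₁`. -/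
noncomputable def backKernel {act : G → M → M} (hact : Measurable fun p : G × M => act p.1 p.2)
    (ν : Measure M) [SFinite ν] (n : ℕ) : Kernel (ℕ → G) M where
  toFun h := ν.map (backComp act n h)
  measurable' := by
    refine Measure.measurable_of_measurable_coe _ fun s hs => ?_
    have h1 : ∀ h, Measurable (backComp act n h) := fun h =>
      (measurable_backComp hact n).comp measurable_prodMk_left
    simp_rw [fun h => Measure.map_apply (μ := ν) (h1 h) hs]
    exact measurable_measure_prodMk_left (measurable_backComp hact n hs)

instance {act : G → M → M} (hact : Measurable fun p : G × M => act p.1 p.2)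
    (ν : Measure M) [IsProbabilityMeasure ν] (n : ℕ) : IsMarkovKernel (backKernel hact ν n) :=
  ⟨fun _ => Measure.isProbabilityMeasure_map
    ((measurable_backComp hact n).comp measurable_prodMk_left).aemeasurable⟩

/-- Stationarity says that the action map sends `μ ⊗ ν` to `ν`. -/
theorem map_prod_eq_of_stationary {act : G → M → M}
    (hact : Measurable fun p : G × M => act p.1 p.2) {μ : Measure G} {ν : Measure M}
    [SFinite μ] [SFinite ν] (hstat : μ.bind (fun g => ν.map (act g)) = ν) :
    (μ.prod ν).map (fun p => act p.1 p.2) = ν := by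
  have h1 : ∀ g, Measurable (act g) := fun g => hact.comp measurable_prodMk_left
  have hmeas : Measurable fun g => ν.map (act g) := by
    refine Measure.measurable_of_measurable_coe _ fun s hs => ?_
    simp_rw [fun g => Measure.map_apply (μ := ν) (h1 g) hs]
    exact measurable_measure_prodMk_left (hact hs)
  conv_rhs => rw [← hstat]
  ext s hs
  rw [Measure.map_apply hact hs, Measure.prod_apply (hact hs),
    Measure.bind_apply hs hmeas.aemeasurable]
  exact lintegral_congr fun g => (Measure.map_apply (h1 g) hs).symm

variable (μ : Measure G) [IsProbabilityMeasure μ] (ν : Measure M) [IsProbabilityMeasure ν]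

/-- The integrals of a bounded function against the measures `(h₀ ∘ ⋯ ∘ hₙ₋₁)_* ν` form a
martingale when `ν` is stationary. -/
theorem exists_martingale_integral_backComp {act : G → M → M}
    (hact : Measurable fun p : G × M => act p.1 p.2)
    (hstat : (μ.prod ν).map (fun p => act p.1 p.2) = ν)
    {f : M → ℝ} (hf : StronglyMeasurable f) {C : ℝ} (hC : ∀ x, ‖f x‖ ≤ C) :
    ∃ ℱ : Filtration ℕ (inferInstance : MeasurableSpace (ℕ → G)),
      Martingale (fun n h => ∫ x, f (backComp act n h x) ∂ν) ℱ (Measure.infinitePi fun _ => μ) := by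
  classical
  obtain ⟨g₀⟩ := nonempty_of_isProbabilityMeasure μ
  let P : Measure (ℕ → G) := Measure.infinitePi fun _ => μ
  let trunc : ℕ → (ℕ → G) → (ℕ → G) := fun n h i => if i < n then h i else g₀
  have htrunc : ∀ n h, backComp act n (trunc n h) = backComp act n h := fun n h =>
    backComp_congr act fun i hi => by simp [trunc, hi]
  have htm : ∀ n, Measurable (trunc n) := by
    intro n
    refine measurable_pi_iff.2 fun i => ?_
    by_cases hi : i < n
    · simpa [trunc, hi] using measurable_pi_apply i
    · simp [trunc, hi]
  let ℱ : Filtration ℕ (inferInstance : MeasurableSpace (ℕ → G)) :=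
    { seq := fun n => MeasurableSpace.comap (trunc n) inferInstance
      mono' := by
        intro n m hnm
        have : trunc n = trunc n ∘ trunc m := by
          funext h i
          by_cases hi : i < n
          · simp [trunc, hi, hi.trans_le hnm]
          · simp [trunc, hi]
        simp only
        rw [this, ← MeasurableSpace.comap_comp]
        exact MeasurableSpace.comap_mono (htm n).comap_le
      le' := fun n => (htm n).comap_le }
  have hsm : ∀ n, StronglyMeasurable fun h : ℕ → G => ∫ x, f (backComp act n h x) ∂ν := fun n =>
    (hf.comp_measurable (measurable_backComp hact n)).integral_prod_right'
  have hbd : ∀ n h, ‖∫ x, f (backComp act n h x) ∂ν‖ ≤ C := fun n h => by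
    simpa using norm_integral_le_of_norm_le_const (μ := ν) (C := C)
      (Eventually.of_forall fun x => hC (backComp act n h x))
  refine ⟨ℱ, martingale_of_setIntegral_eq_succ (fun n => ?_) (fun n => ?_) fun n s hs => ?_⟩
  · have h1 := (hsm n).comp_measurable (comap_measurable (trunc n))
    simpa only [Function.comp_def, htrunc] using h1
  · exact Integrable.of_bound (hsm n).aestronglyMeasurable C (Eventually.of_forall (hbd n))
  · obtain ⟨B, hB, rfl⟩ := hs
    let Φ : (ℕ → G) × G → ℝ := fun p => ∫ x, f (backComp act n p.1 (act p.2 x)) ∂ν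
    have hΦm : StronglyMeasurable Φ := by
      refine StronglyMeasurable.integral_prod_right'
        (f := fun q : ((ℕ → G) × G) × M => f (backComp act n q.1.1 (act q.1.2 q.2)))
        (hf.comp_measurable ((measurable_backComp hact n).comp
          (measurable_fst.fst.prodMk (hact.comp (measurable_fst.snd.prodMk measurable_snd)))))
    have hΦb : ∀ p, ‖Φ p‖ ≤ C := fun p => by
      simpa using norm_integral_le_of_norm_le_const (μ := ν) (C := C)
        (Eventually.of_forall fun x => hC (backComp act n p.1 (act p.2 x)))
    have hΦ : ∀ u, ∫ g, Φ (u, g) ∂μ = ∫ y, f (backComp act n u y) ∂ν := by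
      intro u
      have hu : StronglyMeasurable fun y => f (backComp act n u y) :=
        hf.comp_measurable ((measurable_backComp hact n).comp measurable_prodMk_left)
      conv_rhs => rw [← hstat]
      rw [integral_map hact.aemeasurable hu.aestronglyMeasurable, integral_prod]
      exact Integrable.of_bound (hu.comp_measurable hact).aestronglyMeasurable C
        (Eventually.of_forall fun p => hC _)
    have hjoint : P.map (fun h => (trunc n h, h n)) = (P.map (trunc n)).prod μ := by
      have := infinitePi_map_prodMk μ (S := Set.Iio n) (T := {n}) (u := trunc n)
        (v := fun h => h n) (by simp) ?_ (measurable_apply_of_mem rfl)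
      · rw [Measure.infinitePi_map_eval] at this
        exact this
      · refine (@measurable_pi_iff _ _ _ (_) _ _).2 fun i => ?_
        by_cases hi : i < n
        · simpa [trunc, hi] using measurable_apply_of_mem (S := Set.Iio n) hi
        · simp [trunc, hi]
    have hpm : Measurable fun h : ℕ → G => (trunc n h, h n) :=
      (htm n).prodMk (measurable_pi_apply n)
    have hBm : MeasurableSet (B ×ˢ (Set.univ : Set G)) := hB.prod MeasurableSet.univ
    have : IsProbabilityMeasure (P.map (trunc n)) :=
      Measure.isProbabilityMeasure_map (htm n).aemeasurable
    symm
    calc ∫ h in trunc n ⁻¹' B, (∫ x, f (backComp act (n + 1) h x) ∂ν) ∂P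
        = ∫ h in (fun h => (trunc n h, h n)) ⁻¹' (B ×ˢ Set.univ), Φ (trunc n h, h n) ∂P := by
          have : (fun h => (trunc n h, h n)) ⁻¹' (B ×ˢ Set.univ) = trunc n ⁻¹' B := by
            ext; simp
          rw [this]
          simp only [Φ, htrunc, backComp]
      _ = ∫ p in B ×ˢ Set.univ, Φ p ∂((P.map (trunc n)).prod μ) := by
          rw [← hjoint, setIntegral_map hBm hΦm.aestronglyMeasurable hpm.aemeasurable]
      _ = ∫ u in B, (∫ g, Φ (u, g) ∂μ) ∂(P.map (trunc n)) := by
          rw [setIntegral_prod _ (Integrable.of_bound hΦm.aestronglyMeasurable C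
            (Eventually.of_forall hΦb)).integrableOn]
          simp
      _ = ∫ u in B, (∫ y, f (backComp act n u y) ∂ν) ∂(P.map (trunc n)) := by simp_rw [hΦ]
      _ = ∫ h in trunc n ⁻¹' B, (∫ x, f (backComp act n h x) ∂ν) ∂P := by
          rw [setIntegral_map hB (hsm n).aestronglyMeasurable (htm n).aemeasurable]
          simp only [htrunc]

/-- Two invariant measures for the two-sided skew product with the same projection to the
nonnegative coordinates are equal. -/
theorem ext_of_skewProduct_invariant {act : G → M → M}
    (hact : Measurable fun p : G × M => act p.1 p.2)
    (ρ ρ' : Measure ((ℤ → G) × M)) [IsFiniteMeasure ρ]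
    (hinv : ρ.map (fun p => (fun n => p.1 (n + 1), act (p.1 0) p.2)) = ρ)
    (hinv' : ρ'.map (fun p => (fun n => p.1 (n + 1), act (p.1 0) p.2)) = ρ')
    (h : ρ.map (fun p => (fun n : ℕ => p.1 n, p.2)) =
      ρ'.map (fun p => (fun n : ℕ => p.1 n, p.2))) : ρ = ρ' := by
  let F : (ℤ → G) × M → (ℤ → G) × M := fun p => (fun n => p.1 (n + 1), act (p.1 0) p.2)
  have hev : ∀ i : ℤ, Measurable fun p : (ℤ → G) × M => p.1 i := fun i =>
    (measurable_pi_apply i).comp measurable_fst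
  have hF : Measurable F := (measurable_pi_iff.2 fun n => hev (n + 1)).prodMk
    (hact.comp ((hev 0).prodMk measurable_snd))
  let φ : ℕ → (ℤ → G) × M → (ℕ → G) × M := fun k p => (fun i : ℕ => p.1 (i - k), p.2)
  have hφ : ∀ k, Measurable (φ k) := fun k =>
    (measurable_pi_iff.2 fun i => hev _).prodMk measurable_snd
  have hcoord : ∀ (k : ℕ) (i : ℤ), -(k : ℤ) ≤ i →
      Measurable[MeasurableSpace.comap (φ k) inferInstance] fun p => p.1 i := by
    intro k i hi
    have h1 : Measurable fun q : (ℕ → G) × M => q.1 (i + k).toNat :=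
      (measurable_pi_apply _).comp measurable_fst
    have h2 := h1.comp (comap_measurable (φ k))
    have e : (((i + k).toNat : ℕ) : ℤ) - k = i := by lia
    simpa only [Function.comp_def, φ, e] using h2
  have hsnd : ∀ k : ℕ, Measurable[MeasurableSpace.comap (φ k) inferInstance] Prod.snd := by
    intro k
    have h1 : Measurable (Prod.snd : (ℕ → G) × M → M) := measurable_snd
    exact h1.comp (comap_measurable (φ k))
  refine ext_of_map_eq_of_monotone_comap φ hφ (fun k => ?_) ?_ ρ ρ' fun k => ?_
  · exact Measurable.prodMk ((@measurable_pi_iff _ _ _ (_) _ _).2 fun i =>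
      hcoord _ _ (by push_cast; lia)) (hsnd _)
  · refine sup_le ?_ ?_
    · refine Measurable.comap_le ((@measurable_pi_iff _ _ _ (_) _ _).2 fun i => ?_)
      exact (hcoord i.natAbs i (by lia)).mono
        (le_iSup (fun k => MeasurableSpace.comap (φ k) inferInstance) _) le_rfl
    · exact (hsnd 0).comap_le.trans
        (le_iSup (fun k => MeasurableSpace.comap (φ k) inferInstance) 0)
  · induction k with
    | zero => simpa [φ] using h
    | succ k ih =>
      let ψ : (ℕ → G) × M → (ℕ → G) × M := fun q => (q.1, act (q.1 k) q.2)
      have hevk : Measurable fun q : (ℕ → G) × M => q.1 k :=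
        (measurable_pi_apply k).comp measurable_fst
      have hψ : Measurable ψ :=
        measurable_fst.prodMk (hact.comp (hevk.prodMk measurable_snd))
      have hcomp : φ (k + 1) ∘ F = ψ ∘ φ k := by
        funext p
        simp only [Function.comp, φ, F, ψ, sub_self]
        refine Prod.ext (funext fun i => congrArg p.1 ?_) rfl
        push_cast
        ring
      have hstep : ∀ η : Measure ((ℤ → G) × M), η.map F = η →
          η.map (φ (k + 1)) = (η.map (φ k)).map ψ := by
        intro η hη
        rw [Measure.map_map hψ (hφ k), ← hcomp, ← Measure.map_map (hφ _) hF, hη]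
      rw [hstep ρ hinv, hstep ρ' hinv', ih]

end Dynamics

section Lift

variable {G M : Type*} [MeasurableSpace G] [MetricSpace M] [MeasurableSpace M] [BorelSpace M]
  (μ : Measure G) (ν : Measure M)

/-- The limit kernel is equivariant. -/
theorem map_limit_kernel_eq {act : G → M → M} (hcont : ∀ g, Continuous (act g))
    (κ : Kernel (ℕ → G) M) [IsMarkovKernel κ] {h : ℕ → G}
    (h₁ : ∀ f : C(M, ℝ),
      Tendsto (fun n => ∫ x, f (backComp act n h x) ∂ν) atTop (𝓝 (∫ x, f x ∂κ h)))
    (h₂ : ∀ f : C(M, ℝ),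
      Tendsto (fun n => ∫ x, f (backComp act n (fun i => h (i + 1)) x) ∂ν) atTop
        (𝓝 (∫ x, f x ∂κ fun i => h (i + 1)))) :
    (κ fun i => h (i + 1)).map (act (h 0)) = κ h := by
  have hm := (hcont (h 0)).measurable
  have := Measure.isProbabilityMeasure_map (μ := κ fun i => h (i + 1)) hm.aemeasurable
  refine ext_of_forall_integral_eq_of_IsFiniteMeasure fun f => ?_
  rw [integral_map hm.aemeasurable f.continuous.aestronglyMeasurable]
  refine tendsto_nhds_unique (h₂ (f.toContinuousMap.comp ⟨act (h 0), hcont _⟩)) ?_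
  refine ((h₁ f.toContinuousMap).comp (tendsto_add_atTop_nat 1)).congr fun n => ?_
  simp [backComp_succ_left]

variable [CompactSpace M] [IsProbabilityMeasure μ] [IsProbabilityMeasure ν]

/-- For a stationary measure `ν` and almost every sequence `h`, the measures
`(h₀ ∘ ⋯ ∘ hₙ₋₁)_* ν` converge weakly; the limits form a kernel with barycenter `ν`. -/
theorem exists_limit_kernel {act : G → M → M}
    (hact : Measurable fun p : G × M => act p.1 p.2)
    (hstat : (μ.prod ν).map (fun p => act p.1 p.2) = ν) :
    ∃ κ : Kernel (ℕ → G) M, IsMarkovKernel κ ∧ (Measure.infinitePi fun _ => μ).bind κ = ν ∧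
      ∀ᵐ h ∂(Measure.infinitePi fun _ : ℕ => μ), ∀ f : C(M, ℝ),
        Tendsto (fun n => ∫ x, f (backComp act n h x) ∂ν) atTop (𝓝 (∫ x, f x ∂κ h)) := by
  have hbm : ∀ n h, Measurable (backComp act n h) := fun n h =>
    (measurable_backComp hact n).comp measurable_prodMk_left
  have hint : ∀ (f : C(M, ℝ)) n h,
      ∫ x, f x ∂backKernel hact ν n h = ∫ x, f (backComp act n h x) ∂ν := fun f n h =>
    integral_map (hbm n h).aemeasurable f.continuous.aestronglyMeasurable
  have hbd : ∀ (f : C(M, ℝ)) n h, ‖∫ x, f (backComp act n h x) ∂ν‖ ≤ ‖f‖ := fun f n h => by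
    simpa using norm_integral_le_of_norm_le_const (μ := ν) (C := ‖f‖)
      (Eventually.of_forall fun x => f.norm_coe_le_norm (backComp act n h x))
  have hsm : ∀ (f : C(M, ℝ)) n, StronglyMeasurable fun h => ∫ x, f (backComp act n h x) ∂ν :=
    fun f n =>
      (f.continuous.stronglyMeasurable.comp_measurable
        (measurable_backComp hact n)).integral_prod_right'
  obtain ⟨κ, hκ, hlim⟩ := exists_kernel_ae_tendsto (Measure.infinitePi fun _ : ℕ => μ)
    (backKernel hact ν) (fun f => by
      obtain ⟨ℱ, hmart⟩ := exists_martingale_integral_backComp μ ν hact hstat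
        f.continuous.stronglyMeasurable f.norm_coe_le_norm
      have := hmart.submartingale.ae_tendsto_limitProcess (R := ‖f‖₊) fun n => by
        simpa [enorm_eq_nnnorm] using eLpNorm_le_of_ae_bound (p := 1)
          (μ := Measure.infinitePi fun _ : ℕ => μ) (Eventually.of_forall (hbd f n))
      filter_upwards [this] with h hh
      simp_rw [hint]
      exact ⟨_, hh⟩)
  simp_rw [hint] at hlim
  refine ⟨κ, hκ, ?_, hlim⟩
  refine ext_of_forall_integral_eq_of_IsFiniteMeasure fun f => ?_
  let f' : C(M, ℝ) := f.toContinuousMap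
  obtain ⟨ℱ, hmart⟩ := exists_martingale_integral_backComp μ ν hact hstat
    f'.continuous.stronglyMeasurable f'.norm_coe_le_norm
  have hconst : ∀ n, ∫ h, (∫ x, f' (backComp act n h x) ∂ν) ∂(Measure.infinitePi fun _ => μ) =
      ∫ x, f x ∂ν := by
    intro n
    have := hmart.setIntegral_eq (Nat.zero_le n) MeasurableSet.univ
    simpa [backComp, f'] using this.symm
  have hL := tendsto_integral_of_dominated_convergence (μ := Measure.infinitePi fun _ : ℕ => μ)
    (F := fun n h => ∫ x, f' (backComp act n h x) ∂ν) (f := fun h => ∫ x, f' x ∂κ h)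
    (fun _ => ‖f'‖) (fun n => (hsm f' n).aestronglyMeasurable) (integrable_const _)
    (fun n => Eventually.of_forall (hbd f' n)) (hlim.mono fun h hh => hh f')
  simp_rw [hconst] at hL
  have hf : Integrable (fun p : (ℕ → G) × M => f p.2) ((Measure.infinitePi fun _ => μ) ⊗ₘ κ) :=
    (f.integrable ((Measure.infinitePi fun _ => μ) ⊗ₘ κ).snd).comp_measurable measurable_snd
  rw [← Measure.snd_compProd, Measure.snd,
    integral_map measurable_snd.aemeasurable f.continuous.aestronglyMeasurable,
    Measure.integral_compProd hf]
  exact tendsto_nhds_unique hL tendsto_const_nhds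

/-- Existence of the lift of a stationary measure to the natural extension,
for a measurable family of continuous maps. -/
theorem exists_lift_of_stationary {act : G → M → M}
    (hact : Measurable fun p : G × M => act p.1 p.2) (hcont : ∀ g, Continuous (act g))
    (hstat : (μ.prod ν).map (fun p => act p.1 p.2) = ν) :
    ∃ κ : Kernel (ℕ → G) M, IsMarkovKernel κ ∧
      let νhat := (Measure.infinitePi fun _ : ℤ => μ).bind
        fun ω => (Measure.dirac ω).prod (κ fun n => ω (-(n + 1)))
      IsProbabilityMeasure νhat ∧
      νhat.map (fun p => (fun n => p.1 (n + 1), act (p.1 0) p.2)) = νhat ∧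
      νhat.map (fun p => (fun n : ℕ => p.1 n, p.2)) = (Measure.infinitePi fun _ => μ).prod ν := by
  obtain ⟨κ, hκ, hbary, hlim⟩ := exists_limit_kernel μ ν hact hstat
  refine ⟨κ, hκ, ?_⟩
  let μZ : Measure (ℤ → G) := Measure.infinitePi fun _ => μ
  let past : (ℤ → G) → ℕ → G := fun ω n => ω (-(n + 1))
  let pos : (ℤ → G) → ℕ → G := fun ω n => ω n
  let shift : (ℤ → G) → ℤ → G := fun ω n => ω (n + 1)
  have hpast : Measurable past := by fun_prop
  have hpos : Measurable pos := by fun_prop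
  have hshift : Measurable shift := by fun_prop
  have hpastP : μZ.map past = Measure.infinitePi fun _ => μ :=
    Measure.map_infinitePi_infinitePi_of_inj (P := fun _ : ℤ => μ)
      (f := fun n : ℕ => -((n : ℤ) + 1)) fun i j hij => by simp only at hij; lia
  have hposP : μZ.map pos = Measure.infinitePi fun _ => μ :=
    Measure.map_infinitePi_infinitePi_of_inj (P := fun _ : ℤ => μ)
      (f := fun n : ℕ => (n : ℤ)) Nat.cast_injective
  have hshiftP : μZ.map shift = μZ :=
    Measure.map_infinitePi_infinitePi_of_inj (P := fun _ : ℤ => μ)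
      (f := fun n : ℤ => n + 1) (add_left_injective 1)
  have hjoint : μZ.map (fun ω => (pos ω, past ω)) =
      (Measure.infinitePi fun _ => μ).prod (Measure.infinitePi fun _ => μ) := by
    have := infinitePi_map_prodMk μ (S := Set.Ici (0 : ℤ)) (T := Set.Iio 0) (u := pos) (v := past)
      (Set.disjoint_left.2 fun i hi hi' => absurd hi (by simpa using hi'))
      ((@measurable_pi_iff _ _ _ (_) _ _).2 fun i => measurable_apply_of_mem (by simp))
      ((@measurable_pi_iff _ _ _ (_) _ _).2 fun i =>
        measurable_apply_of_mem (by simp only [Set.mem_Iio]; lia))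
    rwa [hpastP, hposP] at this
  have hνhat : μZ.bind (fun ω => (Measure.dirac ω).prod (κ fun n => ω (-(n + 1)))) =
      μZ ⊗ₘ κ.comap past hpast := by
    rw [Measure.compProd_eq_comp_prod]
    congr 1
    funext ω
    rw [Kernel.prod_apply, Kernel.id_apply, Kernel.comap_apply]
  intro νhat
  rw [show νhat = μZ ⊗ₘ κ.comap past hpast from hνhat]
  refine ⟨inferInstance, ?_, ?_⟩
  · have hF : Measurable fun p : (ℤ → G) × M => (fun n : ℤ => p.1 (n + 1), act (p.1 0) p.2) := by
      have hev : Measurable fun p : (ℤ → G) × M => p.1 0 :=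
        (measurable_pi_apply 0).comp measurable_fst
      exact (hshift.comp measurable_fst).prodMk (hact.comp (hev.prodMk measurable_snd))
    have h₁ : ∀ᵐ ω ∂μZ, ∀ f : C(M, ℝ), Tendsto (fun n => ∫ x, f (backComp act n (past ω) x) ∂ν)
        atTop (𝓝 (∫ x, f x ∂κ (past ω))) :=
      ae_of_ae_map hpast.aemeasurable (hpastP ▸ hlim)
    have h₂ := ae_of_ae_map hshift.aemeasurable (hshiftP.symm ▸ h₁)
    ext s hs
    rw [Measure.map_apply hF hs, Measure.compProd_apply (hF hs), Measure.compProd_apply hs]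
    conv_rhs => rw [← hshiftP]
    rw [lintegral_map (Kernel.measurable_kernel_prodMk_left hs) hshift]
    refine lintegral_congr_ae ?_
    filter_upwards [h₁, h₂] with ω h₁ h₂
    have e : (fun i => past (shift ω) (i + 1)) = past ω := by
      funext i
      simp only [past, shift]
      congr 1
    have e0 : past (shift ω) 0 = ω 0 := by simp [past, shift]
    have key := map_limit_kernel_eq ν hcont κ h₂ (by rw [e]; exact h₁)
    rw [e, e0] at key
    rw [Kernel.comap_apply, Kernel.comap_apply, ← key,
      Measure.map_apply (hcont _).measurable (measurable_prodMk_left hs)]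
    rfl
  · symm
    refine Measure.prod_eq fun A B hA hB => ?_
    have hQ : Measurable fun p : (ℤ → G) × M => (fun n : ℕ => p.1 n, p.2) :=
      (hpos.comp measurable_fst).prodMk measurable_snd
    have hκB : Measurable fun p : (ℕ → G) × (ℕ → G) => κ p.2 B :=
      (κ.measurable_coe hB).comp measurable_snd
    rw [Measure.map_apply hQ (hA.prod hB),
      show (fun p : (ℤ → G) × M => (fun n : ℕ => p.1 n, p.2)) ⁻¹' (A ×ˢ B) =
        (pos ⁻¹' A) ×ˢ B from rfl, Measure.compProd_apply_prod (hpos hA) hB]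
    calc ∫⁻ ω in pos ⁻¹' A, κ.comap past hpast ω B ∂μZ
        = ∫⁻ ω in (fun ω => (pos ω, past ω)) ⁻¹' (A ×ˢ Set.univ), κ (past ω) B ∂μZ := by
          rw [show (fun ω => (pos ω, past ω)) ⁻¹' (A ×ˢ Set.univ) = pos ⁻¹' A by ext; simp]
          rfl
      _ = ∫⁻ p in A ×ˢ Set.univ, κ p.2 B
            ∂((Measure.infinitePi fun _ : ℕ => μ).prod (Measure.infinitePi fun _ : ℕ => μ)) := by
          rw [← hjoint, setLIntegral_map (hA.prod MeasurableSet.univ)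
            hκB (hpos.prodMk hpast)]
      _ = _ := by
          rw [← Measure.prod_restrict, lintegral_prod _ hκB.aemeasurable]
          conv_rhs => rw [← hbary, Measure.bind_apply hB κ.aemeasurable]
          simp [mul_comm]

end Lift

section HomeoAction

variable {M : Type*} [MetricSpace M] [CompactSpace M]

instance : BorelSpace (M ≃ₜ M) := ⟨rfl⟩

instance : SecondCountableTopology (M ≃ₜ M) :=
  Topology.IsInducing.secondCountableTopology
    (f := fun h : M ≃ₜ M =>
      ((ContinuousMap.mk ⇑h h.continuous : C(M, M)),
        (ContinuousMap.mk ⇑h.symm h.symm.continuous : C(M, M)))) ⟨rfl⟩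

/-- Evaluation of homeomorphisms is jointly continuous. -/
theorem continuous_homeomorph_eval : Continuous fun p : (M ≃ₜ M) × M => p.1 p.2 := by
  have h1 : Continuous fun h : M ≃ₜ M => (ContinuousMap.mk ⇑h h.continuous : C(M, M)) :=
    continuous_fst.comp (continuous_induced_dom (f := fun h : M ≃ₜ M =>
      ((ContinuousMap.mk ⇑h h.continuous : C(M, M)),
        (ContinuousMap.mk ⇑h.symm h.symm.continuous : C(M, M)))))
  exact (continuous_eval (F := C(M, M))).comp ((h1.comp continuous_fst).prodMk continuous_snd)

theorem measurable_homeomorph_eval [MeasurableSpace M] [BorelSpace M] :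
    Measurable fun p : (M ≃ₜ M) × M => p.1 p.2 :=
  continuous_homeomorph_eval.measurable

end HomeoAction

end Helpers

/-- (Natural extension / lift of a stationary measure.)  Let `M` be a
compact metric space, `G` its homeomorphism group, `μ` a Borel probability measure on `G`,
`μ^ℤ` and `μ^ℕ` the product measures on `G^ℤ` and `G^ℕ`, `F(ω,x) = (σω, ω₀(x))` the two-sided
skew product and `P⁺` the restriction to nonnegative coordinates.  For every `μ`-stationary
Borel probability `ν` on `M` there is a unique Borel probability measure `ν̂` on `G^ℤ × M`
such that (1) `ν̂` is `F`-invariant and (2) `P⁺_*(ν̂) = μ^ℕ ⊗ ν`.  Moreover `ν̂` disintegrates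
over `G^ℤ` as `ν̂ = ∫ δ_ω ⊗ ν_ω dμ^ℤ(ω)` with a measurable family of sample measures `ν_ω`,
and `ν_ω` depends (`μ^ℤ`-a.e.) only on the coordinates of negative index. -/
theorem exists_unique_lift_of_stationary
    {M : Type*} [MetricSpace M] [CompactSpace M] [MeasurableSpace M] [BorelSpace M]
    (μ : Measure (M ≃ₜ M)) [IsProbabilityMeasure μ]
    (μZ : Measure (ℤ → M ≃ₜ M))
    (hμZ : ∀ (k : ℤ) (n : ℕ),
      μZ.map (fun ω (i : Fin n) => ω (k + (i : ℕ))) = Measure.pi fun _ : Fin n => μ)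
    (μN : Measure (ℕ → M ≃ₜ M))
    (hμN : ∀ n : ℕ, μN.map (fun ω (i : Fin n) => ω i) = Measure.pi fun _ : Fin n => μ)
    (ν : Measure M) [IsProbabilityMeasure ν]
    (hstat : μ.bind (fun h => ν.map (h : M → M)) = ν) :
    ∃ νhat : Measure ((ℤ → M ≃ₜ M) × M), IsProbabilityMeasure νhat ∧
      νhat.map (fun p : (ℤ → M ≃ₜ M) × M => (fun n => p.1 (n + 1), p.1 0 p.2)) = νhat ∧
      νhat.map (fun p : (ℤ → M ≃ₜ M) × M => (fun n : ℕ => p.1 n, p.2)) = μN.prod ν ∧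
      (∀ νhat' : Measure ((ℤ → M ≃ₜ M) × M), IsProbabilityMeasure νhat' →
        νhat'.map (fun p : (ℤ → M ≃ₜ M) × M => (fun n => p.1 (n + 1), p.1 0 p.2)) = νhat' →
        νhat'.map (fun p : (ℤ → M ≃ₜ M) × M => (fun n : ℕ => p.1 n, p.2)) = μN.prod ν →
        νhat' = νhat) ∧
      ∃ νfam : (ℤ → M ≃ₜ M) → Measure M, Measurable νfam ∧
        (∀ᵐ ω ∂μZ, IsProbabilityMeasure (νfam ω)) ∧
        μZ.bind (fun ω => (Measure.dirac ω).prod (νfam ω)) = νhat ∧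
        ∃ g : ({n : ℤ // n < 0} → M ≃ₜ M) → Measure M, Measurable g ∧
          ∀ᵐ ω ∂μZ, νfam ω = g fun n => ω n.1 := by
  have hZ := eq_infinitePi_int_of_map_fin μ μZ hμZ
  have hN := eq_infinitePi_nat_of_map_fin μ μN hμN
  subst hZ hN
  have hact := measurable_homeomorph_eval (M := M)
  have hstat' := map_prod_eq_of_stationary (act := fun (h : M ≃ₜ M) x => h x) hact hstat
  obtain ⟨κ, hκ, hprob, hinv, hproj⟩ := exists_lift_of_stationary μ ν hact
    (fun h => h.continuous) hstat'
  refine ⟨_, hprob, hinv, hproj, fun νhat' _ hinv' hproj' =>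
    ext_of_skewProduct_invariant hact _ _ hinv' hinv (hproj'.trans hproj.symm),
    fun ω => κ fun n => ω (-(n + 1)), κ.measurable.comp (by fun_prop),
    Filter.Eventually.of_forall fun ω => inferInstance, rfl,
    fun η => κ fun n : ℕ => η ⟨-(n + 1), by lia⟩, κ.measurable.comp (by fun_prop),
    Filter.Eventually.of_forall fun ω => rfl⟩
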